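/- (Lemma 4.1) Suppose the random vector W ∈ ℝⁿ has a strongly log-concave distribution with parameter φ > 0. Then for every q ∈ [1,∞] and every t ≥ 0, P{ ‖(1/n)XᵀW‖_q ≥ E[‖(1/n)XᵀW‖_q] + t } ≤ exp( −n φ t² / (2 N_q(X)²) ). -/

import Mathlib

open MeasureTheory ProbabilityTheory
open scoped ENNReal NNReal

noncomputable def lqNorm (q : ℝ≥0∞) {L : ℕ} (v : Fin L → ℝ) : ℝ :=
  (eLpNorm v q Measure.count).toReal

noncomputable def Nq (q : ℝ≥0∞) {n L : ℕ} (X : Fin n → Fin L → ℝ) : ℝ :=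
  lqNorm q (fun j => Real.sqrt ((1 / (n : ℝ)) * ∑ i, (X i j) ^ 2))

noncomputable def gaussianVec (n : ℕ) (σ : ℝ) : Measure (Fin n → ℝ) :=
  Measure.pi (fun _ => gaussianReal 0 ⟨σ ^ 2, sq_nonneg σ⟩)

/-- A strongly log-concave probability distribution on `ℝⁿ` with parameter `φ`:
it has density `exp(−ψ)` w.r.t. Lebesgue measure where `ψ` satisfies the strong
convexity-type inequality. -/
def StronglyLogConcave {n : ℕ} (μ : Measure (Fin n → ℝ)) (φ : ℝ) : Prop :=
  ∃ ψ : (Fin n → ℝ) → ℝ,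
    μ = volume.withDensity (fun z => ENNReal.ofReal (Real.exp (-ψ z))) ∧
      ∀ l : ℝ, l ∈ Set.Icc (0 : ℝ) 1 → ∀ z z' : Fin n → ℝ,
        l * ψ z + (1 - l) * ψ z'
            - ψ (fun i => l * z i + (1 - l) * z' i)
          ≥ φ / 2 * l * (1 - l) * (∑ i, (z i - z' i) ^ 2)

lemma bm_sum_aux (K K' C : Set ℝ) (hK : IsCompact K) (hK' : IsCompact K')
    (h0 : K.Nonempty) (h0' : K'.Nonempty)
    (hC : ∀ x ∈ K, ∀ y ∈ K', x + y ∈ C) : volume K + volume K' ≤ volume C := by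
  obtain ⟨M, hM, hMmax⟩ := hK.exists_isGreatest h0
  obtain ⟨m, hm, hmmin⟩ := hK'.exists_isLeast h0'
  have e1 : volume ((fun x => m + x) '' K) = volume K := by
    rw [Set.image_add_left, measure_preimage_add]
  have e2 : volume ((fun x => M + x) '' K') = volume K' := by
    rw [Set.image_add_left, measure_preimage_add]
  have hd : AEDisjoint volume ((fun x => m + x) '' K) ((fun x => M + x) '' K') := by
    have hs : ((fun x => m + x) '' K) ∩ ((fun x => M + x) '' K') ⊆ {M + m} := by
      rintro z ⟨⟨x, hx, rfl⟩, ⟨y, hy, hxy⟩⟩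
      have h1 := hMmax hx
      have h2 := hmmin hy
      simp only [Set.mem_singleton_iff] at *
      linarith
    exact measure_mono_null hs (by simp)
  have hmeas : MeasurableSet ((fun x => M + x) '' K') :=
    (hK'.image (by fun_prop)).measurableSet
  rw [← e1, ← e2, ← measure_union₀ hmeas.nullMeasurableSet hd]
  apply measure_mono
  rintro z (⟨x, hx, rfl⟩ | ⟨y, hy, rfl⟩)
  · have := hC x hx m hm
    simpa [add_comm] using this
  · exact hC M hM y hy

lemma bm_sum (A B C : Set ℝ) (hA : MeasurableSet A) (hB : MeasurableSet B)
    (h0 : A.Nonempty) (h0' : B.Nonempty)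
    (hC : ∀ x ∈ A, ∀ y ∈ B, x + y ∈ C) : volume A + volume B ≤ volume C := by
  obtain ⟨a, ha⟩ := h0
  obtain ⟨b, hb⟩ := h0'
  rw [hA.measure_eq_iSup_isCompact, hB.measure_eq_iSup_isCompact]
  simp only [iSup_and']
  refine ENNReal.biSup_add_biSup_le' (p := fun K => K ⊆ A ∧ IsCompact K)
    (q := fun K => K ⊆ B ∧ IsCompact K) ⟨∅, by simp⟩ ⟨∅, by simp⟩ ?_
  rintro K ⟨hKA, hK⟩ K' ⟨hKB, hK'⟩
  calc volume K + volume K' ≤ volume (insert a K) + volume (insert b K') := by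
        gcongr <;> exact Set.subset_insert _ _
    _ ≤ volume C := by
        apply bm_sum_aux _ _ _ (hK.insert a) (hK'.insert b) (Set.insert_nonempty _ _)
          (Set.insert_nonempty _ _)
        intro x hx y hy
        exact hC x (Set.insert_subset ha hKA hx) y (Set.insert_subset hb hKB hy)

lemma bm_conv (l : ℝ) (hl : 0 < l) (hl1 : l < 1) (A B C : Set ℝ) (hA : MeasurableSet A)
    (hB : MeasurableSet B) (h0 : A.Nonempty) (h0' : B.Nonempty)
    (hC : ∀ x ∈ A, ∀ y ∈ B, l * x + (1 - l) * y ∈ C) :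
    ENNReal.ofReal l * volume A + ENNReal.ofReal (1 - l) * volume B ≤ volume C := by
  have hm : 0 < 1 - l := by linarith
  have e1 : volume ((fun x => l * x) '' A) = ENNReal.ofReal l * volume A := by
    have := Measure.addHaar_smul (volume : Measure ℝ) l A
    rw [Module.finrank_self, pow_one, abs_of_pos hl] at this
    exact this
  have e2 : volume ((fun x => (1 - l) * x) '' B) = ENNReal.ofReal (1 - l) * volume B := by
    have := Measure.addHaar_smul (volume : Measure ℝ) (1 - l) B
    rw [Module.finrank_self, pow_one, abs_of_pos hm] at this
    exact this
  rw [← e1, ← e2]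
  apply bm_sum
  · exact hA.const_smul₀ l
  · exact hB.const_smul₀ (1 - l)
  · exact h0.image _
  · exact h0'.image _
  · rintro _ ⟨x, hx, rfl⟩ _ ⟨y, hy, rfl⟩
    exact hC x hx y hy

lemma layer_le_one (u : ℝ → ℝ≥0∞) (hu : Measurable u) (hu1 : ∀ x, u x ≤ 1) :
    ∫⁻ x, u x = ∫⁻ t in Set.Ioo (0:ℝ) 1, volume {x | ENNReal.ofReal t < u x} := by
  have h1 : ∫⁻ x, u x = ∫⁻ x, ENNReal.ofReal (u x).toReal := by
    apply lintegral_congr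
    intro x
    rw [ENNReal.ofReal_toReal (ne_top_of_le_ne_top (by simp) (hu1 x))]
  rw [h1, lintegral_eq_lintegral_meas_lt _ (by filter_upwards; simp) (by fun_prop)]
  rw [← Set.Ioo_union_Ici_eq_Ioi (zero_lt_one' ℝ), lintegral_union measurableSet_Ici]
  · have : ∫⁻ t in Set.Ici (1:ℝ), volume {a | t < (u a).toReal} = 0 := by
      rw [setLIntegral_congr_fun (g := fun _ => 0) measurableSet_Ici]
      · simp
      · intro t ht
        have : {a | t < (u a).toReal} = ∅ := by
          ext a
          simp only [Set.mem_ofPred_eq, Set.mem_empty_iff_false, iff_false, not_lt]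
          have := ENNReal.toReal_mono (by simp) (hu1 a)
          simp at this ht
          linarith
        simp [this]
    rw [this, add_zero]
    apply setLIntegral_congr_fun measurableSet_Ioo
    intro t ht
    simp only
    congr 1
    ext x
    simp only [Set.mem_ofPred_eq]
    exact (ENNReal.ofReal_lt_iff_lt_toReal ht.1.le (ne_top_of_le_ne_top (by simp) (hu1 x))).symm
  · rw [Set.disjoint_left]
    rintro x hx hx'
    simp at hx hx'
    linarith

lemma pl_core (l : ℝ) (hl : 0 < l) (hl1 : l < 1) (u v w : ℝ → ℝ≥0∞) (hu : Measurable u)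
    (hv : Measurable v) (hw : Measurable w) (hus : ⨆ x, u x = 1) (hvs : ⨆ x, v x = 1)
    (h : ∀ x y, u x ^ l * v y ^ (1 - l) ≤ w (l * x + (1 - l) * y)) :
    ENNReal.ofReal l * (∫⁻ x, u x) + ENNReal.ofReal (1 - l) * (∫⁻ x, v x) ≤ ∫⁻ x, w x := by
  have hu1 : ∀ x, u x ≤ 1 := fun x => hus ▸ le_iSup u x
  have hv1 : ∀ x, v x ≤ 1 := fun x => hvs ▸ le_iSup v x
  calc _ ≤ ∫⁻ x, min (w x) 1 := by
        rw [layer_le_one u hu hu1, layer_le_one v hv hv1,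
          layer_le_one _ (hw.min measurable_const) (fun x => min_le_right _ _)]
        have hmeas : ∀ g : ℝ → ℝ≥0∞, Measurable
            (fun t : ℝ => volume {x | ENNReal.ofReal t < g x}) := by
          intro g
          apply Antitone.measurable
          intro a b hab
          apply measure_mono
          intro x hx
          exact lt_of_le_of_lt (ENNReal.ofReal_le_ofReal hab) hx
        rw [← lintegral_const_mul _ (hmeas u), ← lintegral_const_mul _ (hmeas v),
          ← lintegral_add_left ((hmeas u).const_mul _)]
        apply setLIntegral_mono' measurableSet_Ioo
        intro t ht
        have ht1 : ENNReal.ofReal t < 1 := by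
          rw [← ENNReal.ofReal_one]
          exact (ENNReal.ofReal_lt_ofReal_iff (by simp)).2 ht.2
        apply bm_conv l hl hl1 _ _ _ (measurableSet_lt measurable_const hu)
          (measurableSet_lt measurable_const hv)
        · exact lt_iSup_iff.1 (hus ▸ ht1)
        · exact lt_iSup_iff.1 (hvs ▸ ht1)
        · intro x hx y hy
          refine lt_min ?_ ht1
          refine lt_of_lt_of_le ?_ (h x y)
          have hm : 0 < 1 - l := by linarith
          calc ENNReal.ofReal t = ENNReal.ofReal t ^ l * ENNReal.ofReal t ^ (1 - l) := by
                rw [← ENNReal.rpow_add_of_nonneg _ _ hl.le hm.le]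
                simp
            _ < _ := ENNReal.mul_lt_mul (ENNReal.rpow_lt_rpow hx hl) (ENNReal.rpow_lt_rpow hy hm)
    _ ≤ _ := lintegral_mono fun x => min_le_left _ _

lemma ennreal_amgm (l : ℝ) (hl : 0 < l) (hl1 : l < 1) (a b : ℝ≥0∞) :
    a ^ l * b ^ (1 - l) ≤ ENNReal.ofReal l * a + ENNReal.ofReal (1 - l) * b := by
  have hm : 0 < 1 - l := by linarith
  by_cases ha : a = ⊤
  · simp [ha, ENNReal.mul_top, hl]
  by_cases hb : b = ⊤
  · simp [hb, ENNReal.mul_top, hm, hl1]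
  lift a to ℝ≥0 using ha
  lift b to ℝ≥0 using hb
  have := NNReal.geom_mean_le_arith_mean2_weighted ⟨l, hl.le⟩ ⟨1 - l, hm.le⟩ a b
    (by apply NNReal.coe_injective; change l + (1 - l) = 1; ring)
  rw [← ENNReal.coe_rpow_of_nonneg _ hl.le, ← ENNReal.coe_rpow_of_nonneg _ hm.le,
    ENNReal.ofReal, ENNReal.ofReal, Real.toNNReal_of_nonneg hl.le, Real.toNNReal_of_nonneg hm.le]
  exact_mod_cast this

lemma pl_bdd (l : ℝ) (hl : 0 < l) (hl1 : l < 1) (u v w : ℝ → ℝ≥0∞) (hu : Measurable u)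
    (hv : Measurable v) (hw : Measurable w) (hus : ⨆ x, u x ≠ ⊤) (hvs : ⨆ x, v x ≠ ⊤)
    (h : ∀ x y, u x ^ l * v y ^ (1 - l) ≤ w (l * x + (1 - l) * y)) :
    (∫⁻ x, u x) ^ l * (∫⁻ x, v x) ^ (1 - l) ≤ ∫⁻ x, w x := by
  have hm : 0 < 1 - l := by linarith
  set U := ⨆ x, u x with hU
  set V := ⨆ x, v x with hV
  by_cases hU0 : U = 0
  · have : ∀ x, u x = 0 := by simpa [hU] using hU0
    simp [this, hl]
  by_cases hV0 : V = 0
  · have : ∀ x, v x = 0 := by simpa [hV] using hV0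
    simp [this, hl1]
  have key := pl_core l hl hl1 (fun x => U⁻¹ * u x) (fun x => V⁻¹ * v x)
    (fun x => (U⁻¹ ^ l * V⁻¹ ^ (1 - l)) * w x) (hu.const_mul _) (hv.const_mul _) (hw.const_mul _)
    (by rw [← ENNReal.mul_iSup, ENNReal.inv_mul_cancel hU0 hus])
    (by rw [← ENNReal.mul_iSup, ENNReal.inv_mul_cancel hV0 hvs])
    (by
      intro x y
      rw [ENNReal.mul_rpow_of_nonneg _ _ hl.le, ENNReal.mul_rpow_of_nonneg _ _ hm.le,
        mul_mul_mul_comm]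
      gcongr
      exact h x y)
  have k2 := (ennreal_amgm l hl hl1 _ _).trans key
  rw [lintegral_const_mul _ hu, lintegral_const_mul _ hv, lintegral_const_mul _ hw,
    ENNReal.mul_rpow_of_nonneg _ _ hl.le, ENNReal.mul_rpow_of_nonneg _ _ hm.le,
        mul_mul_mul_comm] at k2
  refine (ENNReal.mul_le_mul_iff_right ?_ ?_).1 k2
  · apply mul_ne_zero
    · simp [ENNReal.rpow_eq_zero_iff, hus, hl.le]
    · simp [ENNReal.rpow_eq_zero_iff, hvs, hl1.le]
  · apply ENNReal.mul_ne_top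
    · apply ENNReal.rpow_ne_top_of_nonneg hl.le
      simpa using hU0
    · apply ENNReal.rpow_ne_top_of_nonneg hm.le
      simpa using hV0

lemma lint_trunc (u : ℝ → ℝ≥0∞) (hu : Measurable u) :
    ∫⁻ x, u x = ⨆ N : ℕ, ∫⁻ x, min (u x) N := by
  rw [← lintegral_iSup]
  · apply lintegral_congr
    intro x
    rw [← inf_iSup_eq, ENNReal.iSup_natCast]
    simp
  · intro N
    exact hu.min measurable_const
  · intro a b hab x
    simp only
    gcongr

lemma pl_one (l : ℝ) (hl : 0 < l) (hl1 : l < 1) (u v w : ℝ → ℝ≥0∞) (hu : Measurable u)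
    (hv : Measurable v) (hw : Measurable w)
    (h : ∀ x y, u x ^ l * v y ^ (1 - l) ≤ w (l * x + (1 - l) * y)) :
    (∫⁻ x, u x) ^ l * (∫⁻ x, v x) ^ (1 - l) ≤ ∫⁻ x, w x := by
  have hm : 0 < 1 - l := by linarith
  have key : ∀ N : ℕ, (∫⁻ x, min (u x) N) ^ l * (∫⁻ x, min (v x) N) ^ (1 - l) ≤ ∫⁻ x, w x := by
    intro N
    apply pl_bdd l hl hl1 _ _ _ (hu.min measurable_const) (hv.min measurable_const) hw
    · exact ne_top_of_le_ne_top (ENNReal.natCast_ne_top N) (iSup_le fun x => min_le_right _ _)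
    · exact ne_top_of_le_ne_top (ENNReal.natCast_ne_top N) (iSup_le fun x => min_le_right _ _)
    · intro x y
      refine le_trans ?_ (h x y)
      gcongr <;> exact min_le_left _ _
  have hsup : ∀ (a : ℝ) (ha : 0 < a) (f : ℕ → ℝ≥0∞), (⨆ N, f N) ^ a = ⨆ N, f N ^ a := by
    intro a ha f
    exact (ENNReal.orderIsoRpow a ha).map_iSup f
  rw [lint_trunc u hu, lint_trunc v hv, hsup l hl, hsup _ hm, ENNReal.iSup_mul]
  refine iSup_le fun N => ?_
  rw [ENNReal.mul_iSup]
  refine iSup_le fun M => ?_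
  refine le_trans ?_ (key (max N M))
  gcongr
  · exact le_max_left _ _
  · exact le_max_right _ _

lemma pl_n (l : ℝ) (hl : 0 < l) (hl1 : l < 1) (n : ℕ) : ∀ (u v w : (Fin n → ℝ) → ℝ≥0∞)
    (_ : Measurable u) (_ : Measurable v) (_ : Measurable w)
    (_ : ∀ x y, u x ^ l * v y ^ (1 - l) ≤ w (fun i => l * x i + (1 - l) * y i)),
    (∫⁻ x, u x) ^ l * (∫⁻ x, v x) ^ (1 - l) ≤ ∫⁻ x, w x := by
  induction n with
  | zero =>
    intro u v w hu hv hw h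
    have e : ∀ g : (Fin 0 → ℝ) → ℝ≥0∞, ∫⁻ x, g x = g 0 := by
      intro g
      rw [lintegral_unique]
      have hd : ∀ d, g d = g 0 := fun d => congrArg g (Subsingleton.elim _ _)
      rw [hd]
      simp [volume_pi]
    rw [e, e, e]
    refine (h 0 0).trans (le_of_eq ?_)
    congr 1
    exact Subsingleton.elim _ _
  | succ n ih =>
    intro u v w hu hv hw h
    have mc : Measurable (fun p : ℝ × (Fin n → ℝ) => (Fin.cons p.1 p.2 : Fin (n+1) → ℝ)) := by
      rw [measurable_pi_iff]
      intro i
      refine Fin.cases ?_ (fun j => ?_) i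
      · simpa using measurable_fst
      · simp only [Fin.cons_succ]
        fun_prop
    have e : ∀ g : (Fin (n+1) → ℝ) → ℝ≥0∞, Measurable g →
        ∫⁻ x, g x = ∫⁻ a : ℝ, ∫⁻ z : Fin n → ℝ, g (Fin.cons a z : Fin (n+1) → ℝ) := by
      intro g hg
      have hp := (volume_preserving_piFinSuccAbove (fun _ : Fin (n+1) => ℝ) 0).symm
      rw [← hp.lintegral_comp hg]
      rw [Measure.volume_eq_prod, lintegral_prod]
      · refine lintegral_congr fun a => lintegral_congr fun z => congrArg g ?_
        exact Fin.insertNth_zero' a z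
      · exact (hg.comp (MeasurableEquiv.measurable _)).aemeasurable
    have me : ∀ g : (Fin (n+1) → ℝ) → ℝ≥0∞, Measurable g →
        Measurable (fun a : ℝ => ∫⁻ z : Fin n → ℝ, g (Fin.cons a z : Fin (n+1) → ℝ)) := by
      intro g hg
      exact (hg.comp mc).lintegral_prod_right'
    rw [e u hu, e v hv, e w hw]
    apply pl_one l hl hl1 _ _ _ (me u hu) (me v hv) (me w hw)
    intro a b
    apply ih
    · exact hu.comp (mc.comp measurable_prodMk_left)
    · exact hv.comp (mc.comp measurable_prodMk_left)
    · exact hw.comp (mc.comp measurable_prodMk_left)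
    · intro x y
      refine (h _ _).trans (le_of_eq ?_)
      congr 1
      ext i
      refine Fin.cases ?_ (fun j => ?_) i <;> simp

lemma slc_pl {n : ℕ} (μ : Measure (Fin n → ℝ)) (φ : ℝ) (hφ : 0 < φ)
    (hμ : StronglyLogConcave μ φ) (l : ℝ) (hl : 0 < l) (hl1 : l < 1)
    (g h m : (Fin n → ℝ) → ℝ) (hg : Continuous g) (hh : Continuous h) (hm : Continuous m)
    (H : ∀ x y : Fin n → ℝ, l * g x + (1 - l) * h y - φ / 2 * l * (1 - l) * ∑ i, (x i - y i) ^ 2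
      ≤ m (fun i => l * x i + (1 - l) * y i)) :
    (∫⁻ x, ENNReal.ofReal (Real.exp (g x)) ∂μ) ^ l *
      (∫⁻ x, ENNReal.ofReal (Real.exp (h x)) ∂μ) ^ (1 - l)
      ≤ ∫⁻ x, ENNReal.ofReal (Real.exp (m x)) ∂μ := by
  obtain ⟨ψ, rfl, hψ⟩ := hμ
  have hl' : 0 < 1 - l := by linarith
  have hconv : ConvexOn ℝ Set.univ ψ := by
    refine ⟨convex_univ, ?_⟩
    intro x _ y _ a b ha hb hab
    have hb' : b = 1 - a := by linarith
    subst hb'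
    have h1 := hψ a ⟨ha, by linarith⟩ x y
    have h2 : 0 ≤ φ / 2 * a * (1 - a) * ∑ i, (x i - y i) ^ 2 := by positivity
    have h3 : a • x + (1 - a) • y = fun i => a * x i + (1 - a) * y i := by
      ext i; simp
    rw [h3]
    simp only [smul_eq_mul]
    linarith
  have hcont : Continuous ψ := hconv.locallyLipschitz.continuous
  have e : ∀ k : (Fin n → ℝ) → ℝ, Continuous k →
      ∫⁻ x, ENNReal.ofReal (Real.exp (k x))
        ∂(volume.withDensity (fun z => ENNReal.ofReal (Real.exp (-ψ z))))
      = ∫⁻ x, ENNReal.ofReal (Real.exp (k x - ψ x)) := by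
    intro k hk
    rw [lintegral_withDensity_eq_lintegral_mul _ (by fun_prop) (by fun_prop)]
    apply lintegral_congr
    intro x
    simp only [Pi.mul_apply]
    rw [← ENNReal.ofReal_mul (Real.exp_pos _).le, ← Real.exp_add]
    congr 2
    ring
  rw [e g hg, e h hh, e m hm]
  apply pl_n l hl hl1 n _ _ _ (by fun_prop) (by fun_prop) (by fun_prop)
  intro x y
  rw [ENNReal.ofReal_rpow_of_pos (Real.exp_pos _), ENNReal.ofReal_rpow_of_pos (Real.exp_pos _),
    ← ENNReal.ofReal_mul (by positivity), ← Real.exp_mul, ← Real.exp_mul, ← Real.exp_add]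
  apply ENNReal.ofReal_le_ofReal
  apply Real.exp_le_exp.2
  have h1 := hψ l ⟨hl.le, hl1.le⟩ x y
  have h2 := H x y
  linarith

lemma slc_conc {n : ℕ} (μ : Measure (Fin n → ℝ)) [IsProbabilityMeasure μ] (φ : ℝ) (hφ : 0 < φ)
    (hμ : StronglyLogConcave μ φ) (f : (Fin n → ℝ) → ℝ) (K : ℝ) (hK : 0 < K) (hf0 : ∀ x, 0 ≤ f x)
    (hf : ∀ x y : Fin n → ℝ, f x - f y ≤ K * Real.sqrt (∑ i, (x i - y i) ^ 2))
    (t : ℝ) (ht : 0 ≤ t) :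
    μ.real {w | ∫ w', f w' ∂μ + t ≤ f w} ≤ Real.exp (-(φ * t ^ 2) / (2 * K ^ 2)) := by
  have hcont : Continuous f := by
    rw [continuous_iff_continuousAt]
    intro x
    have h0 : Filter.Tendsto (fun y : Fin n → ℝ => K * Real.sqrt (∑ i, (y i - x i) ^ 2))
        (nhds x) (nhds 0) := by
      have : Continuous (fun y : Fin n → ℝ => K * Real.sqrt (∑ i, (y i - x i) ^ 2)) := by fun_prop
      simpa using this.tendsto x
    refine tendsto_iff_dist_tendsto_zero.2 (squeeze_zero (fun _ => dist_nonneg) ?_ h0)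
    intro y
    rw [Real.dist_eq, abs_le]
    have h1 := hf x y
    have h2 := hf y x
    have h3 : ∑ i, (x i - y i) ^ 2 = ∑ i, (y i - x i) ^ 2 :=
      Finset.sum_congr rfl fun i _ => by ring
    rw [h3] at h1
    constructor <;> linarith
  -- exponential integrability
  have hint : ∀ s : ℝ, Integrable (fun x => Real.exp (s * f x)) μ := by
    intro s
    by_cases hs : s ≤ 0
    · refine Integrable.of_bound (C := 1) (by fun_prop) ?_
      filter_upwards with x
      rw [Real.norm_eq_abs, abs_of_pos (Real.exp_pos _), Real.exp_le_one_iff]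
      exact mul_nonpos_of_nonpos_of_nonneg hs (hf0 x)
    push Not at hs
    have key := slc_pl μ φ hφ hμ (1/2) (by norm_num) (by norm_num) (fun x => s * f x)
      (fun x => -(s * f x)) (fun _ => s ^ 2 * K ^ 2 / (2 * φ)) (by fun_prop) (by fun_prop)
      (by fun_prop) (by
        intro x y
        have h1 := hf x y
        set r := Real.sqrt (∑ i, (x i - y i) ^ 2) with hr
        have h2 : ∑ i, (x i - y i) ^ 2 = r ^ 2 := by
          rw [hr, Real.sq_sqrt (by positivity)]
        rw [h2]
        have h3 : s * (f x - f y) ≤ s * (K * r) := by gcongr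
        have h4 : s ^ 2 * K ^ 2 / (2 * φ) - s * K * r / 2 + φ / 8 * r ^ 2
            = (2 * s * K - φ * r) ^ 2 / (8 * φ) := by
          field_simp; ring
        have h5 : 0 ≤ (2 * s * K - φ * r) ^ 2 / (8 * φ) := by positivity
        nlinarith)
    have hne : (∫⁻ x, ENNReal.ofReal (Real.exp (-(s * f x))) ∂μ) ≠ 0 := by
      rw [Ne, lintegral_eq_zero_iff (by fun_prop)]
      intro h
      have h' : ∀ᵐ x ∂μ, False := by
        filter_upwards [h] with x hx
        have := Real.exp_pos (-(s * f x))
        simp at hx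
        linarith
      simp at h'
      exact IsProbabilityMeasure.ne_zero μ h'
    refine ⟨by fun_prop, ?_⟩
    rw [hasFiniteIntegral_iff_ofReal (by filter_upwards with x; positivity)]
    by_contra htop
    rw [not_lt_top_iff.1 htop] at key
    rw [ENNReal.top_rpow_of_pos (by norm_num), ENNReal.top_mul] at key
    · simp at key
    · simp [ENNReal.rpow_eq_zero_iff, hne]
      norm_num
  have hset : integrableExpSet f μ = Set.univ := by
    ext s; simpa [integrableExpSet] using hint s
  have h0mem : (0:ℝ) ∈ interior (integrableExpSet f μ) := by simp [hset]
  -- cgf bound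
  have hA : ∀ s l : ℝ, 0 ≤ s → 0 < l → l < 1 →
      l * cgf f μ s ≤ cgf f μ (l * s) + l * (1 - l) * (s ^ 2 * K ^ 2 / (2 * φ)) := by
    intro s l hs hl hl1
    have hl' : 0 < 1 - l := by linarith
    set c := l * (1 - l) * (s ^ 2 * K ^ 2 / (2 * φ)) with hc
    have key := slc_pl μ φ hφ hμ l hl hl1 (fun x => s * f x)
      (fun _ => 0) (fun x => l * s * f x + c) (by fun_prop) (by fun_prop)
      (by fun_prop) (by
        intro x y
        have h1 := hf x (fun i => l * x i + (1 - l) * y i)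
        set r := Real.sqrt (∑ i, (x i - y i) ^ 2) with hr
        have h2 : ∑ i, (x i - y i) ^ 2 = r ^ 2 := by
          rw [hr, Real.sq_sqrt (by positivity)]
        have h2' : Real.sqrt (∑ i, (x i - (l * x i + (1 - l) * y i)) ^ 2) = (1 - l) * r := by
          have : ∑ i, (x i - (l * x i + (1 - l) * y i)) ^ 2 = ((1 - l) * r) ^ 2 := by
            rw [mul_pow, ← h2, Finset.mul_sum]
            exact Finset.sum_congr rfl fun i _ => by ring
          rw [this, Real.sqrt_sq (by positivity)]
        rw [h2'] at h1
        rw [h2]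
        have h3 : l * s * (f x - f (fun i => l * x i + (1 - l) * y i))
          ≤ l * s * (K * ((1 - l) * r)) := by gcongr
        have h4 : c - l * s * (K * ((1 - l) * r)) + φ / 2 * l * (1 - l) * r ^ 2
            = l * (1 - l) * ((s * K - φ * r) ^ 2 / (2 * φ)) := by
          rw [hc]; field_simp; ring
        have h5 : 0 ≤ l * (1 - l) * ((s * K - φ * r) ^ 2 / (2 * φ)) := by positivity
        linarith)
    have e : ∀ s : ℝ, ∫⁻ x, ENNReal.ofReal (Real.exp (s * f x)) ∂μ
        = ENNReal.ofReal (mgf f μ s) := by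
      intro s
      rw [mgf, ofReal_integral_eq_lintegral_ofReal (hint s)
        (by filter_upwards with x; positivity)]
    have e2 : ∫⁻ x, ENNReal.ofReal (Real.exp (l * s * f x + c)) ∂μ
        = ENNReal.ofReal (mgf f μ (l * s) * Real.exp c) := by
      rw [ENNReal.ofReal_mul mgf_nonneg, ← e, ← lintegral_mul_const _ (by fun_prop)]
      apply lintegral_congr
      intro x
      rw [Real.exp_add, ENNReal.ofReal_mul (Real.exp_pos _).le]
    rw [e, e2, ENNReal.ofReal_rpow_of_pos (mgf_pos (hint s))] at key
    simp only [Real.exp_zero, ENNReal.ofReal_one, lintegral_const, measure_univ, mul_one,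
      ENNReal.one_rpow] at key
    have hp := mgf_pos (hint (l * s))
    rw [ENNReal.ofReal_le_ofReal_iff (by positivity)] at key
    have hlog := Real.log_le_log (Real.rpow_pos_of_pos (mgf_pos (hint s)) _) key
    rw [Real.log_rpow (mgf_pos (hint s)), Real.log_mul hp.ne' (Real.exp_pos _).ne',
      Real.log_exp] at hlog
    exact hlog
  have hB : ∀ s : ℝ, 0 ≤ s → cgf f μ s ≤ s * (∫ w, f w ∂μ) + s ^ 2 * K ^ 2 / (2 * φ) := by
    intro s hs
    have hd : HasDerivAt (cgf f μ) (∫ w, f w ∂μ) 0 := by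
      have := (analyticAt_cgf h0mem).differentiableAt.hasDerivAt
      rw [deriv_cgf_zero h0mem] at this
      simpa using this
    have hd2 : HasDerivAt (fun l => cgf f μ (l * s)) ((∫ w, f w ∂μ) * s) 0 := by
      have hd' : HasDerivAt (cgf f μ) (∫ w, f w ∂μ) (0 * s) := by simpa using hd
      have := hd'.comp (0:ℝ) ((hasDerivAt_id (0:ℝ)).mul_const s)
      simpa [Function.comp_def] using this
    have hlim := (hasDerivAt_iff_tendsto_slope.1 hd2).mono_left
      (nhdsWithin_mono (0:ℝ) (s := Set.Ioi 0) (fun x hx => ne_of_gt hx))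
    have hlim2 := hlim.add_const (s ^ 2 * K ^ 2 / (2 * φ))
    rw [mul_comm s]
    refine ge_of_tendsto hlim2 ?_
    filter_upwards [Ioo_mem_nhdsGT (zero_lt_one' ℝ)] with l hl
    have h1 := hA s l hs hl.1 hl.2
    have h2 : slope (fun l => cgf f μ (l * s)) 0 l = cgf f μ (l * s) / l := by
      simp [slope_def_field]
    rw [h2]
    have h3 : cgf f μ s ≤ cgf f μ (l * s) / l + (1 - l) * (s ^ 2 * K ^ 2 / (2 * φ)) := by
      have hl0 := hl.1
      rw [← mul_le_mul_iff_right₀ hl0]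
      calc _ ≤ _ := h1
        _ = _ := by field_simp
    have h4 : 0 ≤ l * (s ^ 2 * K ^ 2 / (2 * φ)) := by
      have := hl.1
      positivity
    linarith
  have hs : 0 ≤ φ * t / K ^ 2 := by positivity
  refine (measure_ge_le_exp_cgf _ hs (hint _)).trans (Real.exp_le_exp.2 ?_)
  have := hB _ hs
  calc _ ≤ -(φ * t / K ^ 2) * (∫ w', f w' ∂μ + t) + (φ * t / K ^ 2 * (∫ w, f w ∂μ) +
        (φ * t / K ^ 2) ^ 2 * K ^ 2 / (2 * φ)) := by gcongr
    _ = _ := by field_simp; ring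

lemma lq_memLp (q : ℝ≥0∞) {L : ℕ} (v : Fin L → ℝ) : MemLp v q Measure.count :=
  MemLp.of_discrete

lemma lq_mono (q : ℝ≥0∞) {L : ℕ} (v w : Fin L → ℝ) (h : ∀ j, |v j| ≤ w j) :
    lqNorm q v ≤ lqNorm q w := by
  unfold lqNorm
  apply ENNReal.toReal_mono (lq_memLp q w).eLpNorm_ne_top
  exact eLpNorm_mono_real h

lemma lq_add (q : ℝ≥0∞) (hq : 1 ≤ q) {L : ℕ} (v w : Fin L → ℝ) :
    lqNorm q (fun j => v j + w j) ≤ lqNorm q v + lqNorm q w := by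
  unfold lqNorm
  rw [← ENNReal.toReal_add (lq_memLp q v).eLpNorm_ne_top (lq_memLp q w).eLpNorm_ne_top]
  apply ENNReal.toReal_mono
  · exact ENNReal.add_ne_top.2 ⟨(lq_memLp q v).eLpNorm_ne_top, (lq_memLp q w).eLpNorm_ne_top⟩
  · exact eLpNorm_add_le (lq_memLp q v).1 (lq_memLp q w).1 hq

lemma lq_smul (q : ℝ≥0∞) {L : ℕ} (c : ℝ) (hc : 0 ≤ c) (v : Fin L → ℝ) :
    lqNorm q (fun j => c * v j) = c * lqNorm q v := by
  unfold lqNorm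
  have := eLpNorm_const_smul c v q (Measure.count : Measure (Fin L))
  have e : c • v = fun j => c * v j := by ext; simp
  rw [e] at this
  rw [this, ENNReal.toReal_mul]
  simp [abs_of_nonneg hc]

/-- Lemma 4.1: concentration for strongly log-concave noise. -/
theorem log_concave_concentration_lqNorm
    (n L : ℕ) (hn : 1 ≤ n) (hL : 1 ≤ L) (X : Fin n → Fin L → ℝ)
    (φ : ℝ) (hφ : 0 < φ) (μ : Measure (Fin n → ℝ)) [IsProbabilityMeasure μ]
    (hμ : StronglyLogConcave μ φ)
    (q : ℝ≥0∞) (hq : 1 ≤ q) (t : ℝ) (ht : 0 ≤ t) :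
    (μ {w : Fin n → ℝ |
        lqNorm q (fun j => (1 / (n : ℝ)) * ∑ i, X i j * w i)
          ≥ (∫ w', lqNorm q (fun j => (1 / (n : ℝ)) * ∑ i, X i j * w' i) ∂μ)
            + t}).toReal
      ≤ Real.exp (-(n * φ * t ^ 2) / (2 * (Nq q X) ^ 2)) := by
  have hn0 : (0:ℝ) < n := by exact_mod_cast hn
  have hN0 : 0 ≤ Nq q X := ENNReal.toReal_nonneg
  rcases hN0.eq_or_lt with hN | hN
  · rw [← hN]
    refine (measureReal_le_one (μ := μ)).trans ?_
    simp
  have hsn : 0 < Real.sqrt n := Real.sqrt_pos.2 hn0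
  have key := slc_conc μ φ hφ hμ
    (fun w => lqNorm q (fun j => (1 / (n : ℝ)) * ∑ i, X i j * w i)) (Nq q X / Real.sqrt n)
    (by positivity) (fun _ => ENNReal.toReal_nonneg) (by
      intro x y
      have h1 := lq_add q hq (fun j => (1 / (n : ℝ)) * ∑ i, X i j * y i)
        (fun j => (1 / (n : ℝ)) * ∑ i, X i j * (x i - y i))
      have e1 : (fun j => (1 / (n : ℝ)) * ∑ i, X i j * y i
          + (1 / (n : ℝ)) * ∑ i, X i j * (x i - y i))
          = fun j => (1 / (n : ℝ)) * ∑ i, X i j * x i := by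
        ext j
        rw [← mul_add, ← Finset.sum_add_distrib]
        congr 1
        exact Finset.sum_congr rfl fun i _ => by ring
      rw [e1] at h1
      set r := Real.sqrt (∑ i, (x i - y i) ^ 2) with hr
      have hr0 : 0 ≤ r := Real.sqrt_nonneg _
      have h2 : lqNorm q (fun j => (1 / (n : ℝ)) * ∑ i, X i j * (x i - y i))
          ≤ lqNorm q (fun j => (r / Real.sqrt n) *
            Real.sqrt ((1 / (n : ℝ)) * ∑ i, (X i j) ^ 2)) := by
        apply lq_mono
        intro j
        have hcs : |∑ i, X i j * (x i - y i)| ≤ Real.sqrt (∑ i, (X i j) ^ 2) * r := by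
          rw [hr, ← Real.sqrt_mul (by positivity)]
          exact Real.abs_le_sqrt (Finset.sum_mul_sq_le_sq_mul_sq _ _ _)
        rw [abs_mul, abs_of_pos (by positivity : 0 < 1 / (n:ℝ)), Real.sqrt_mul (by positivity),
          Real.sqrt_div (by norm_num), Real.sqrt_one]
        calc _ ≤ 1 / (n:ℝ) * (Real.sqrt (∑ i, (X i j) ^ 2) * r) := by gcongr
          _ = r / (Real.sqrt n * Real.sqrt n) * Real.sqrt (∑ i, (X i j) ^ 2) := by
            rw [Real.mul_self_sqrt hn0.le]; ring
          _ = _ := by field_simp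
      rw [lq_smul q (r / Real.sqrt n) (by positivity)] at h2
      have h3 : Nq q X / Real.sqrt n * r = r / Real.sqrt n *
        lqNorm q (fun j => Real.sqrt ((1 / (n : ℝ)) * ∑ i, (X i j) ^ 2)) := by
        unfold Nq; ring
      rw [h3]
      linarith) t ht
  have e : -(φ * t ^ 2) / (2 * (Nq q X / Real.sqrt n) ^ 2)
      = -(n * φ * t ^ 2) / (2 * (Nq q X) ^ 2) := by
    rw [div_pow, Real.sq_sqrt hn0.le]
    field_simp
  rw [e] at key
  exact key
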